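/- Let F and G be nonzero homogeneous polynomials in ℂ[x,y,z], both of degree n, with no common nonconstant factor, and suppose their common zero set S in ℙ²(ℂ) consists of exactly n² distinct points. Let E be an irreducible homogeneous polynomial of degree m < n and let T ⊆ S be a subset of exactly n·m points at all of which E vanishes. Then there exists a nonzero homogeneous polynomial of some degree d ≤ n − m which vanishes at all n·(n−m) points of S \ T. -/

import Mathlib

open MvPolynomial

noncomputable section

/-- Polynomials in three variables over `ℂ`. -/
abbrev Poly3 : Type := MvPolynomial (Fin 3) ℂ

/-- The complex projective plane `ℙ²(ℂ)`, the projectivization of `ℂ³`. -/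
abbrev ProjPlane : Type := Projectivization ℂ (Fin 3 → ℂ)

/-- A (homogeneous) polynomial vanishes at a projective point if it vanishes at its
canonical nonzero representative vector (for homogeneous polynomials this is equivalent
to vanishing at any nonzero representative vector). -/
def VanishesAt (F : Poly3) (p : ProjPlane) : Prop :=
  MvPolynomial.eval p.rep F = 0

/-- The set of points of `ℙ²(ℂ)` at which `F` vanishes. -/
def zeroSet (F : Poly3) : Set ProjPlane := {p | VanishesAt F p}

/-- Two defining polynomials give the same curve iff they are proportional by a
nonzero scalar. -/
def ProportionalTo (F G : Poly3) : Prop := ∃ c : ℂ, c ≠ 0 ∧ G = c • F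

/-- A set of points is collinear if some nonzero homogeneous polynomial of degree 1
vanishes at all of them. -/
def Collin (s : Set ProjPlane) : Prop :=
  ∃ L : Poly3, L ≠ 0 ∧ L.IsHomogeneous 1 ∧ ∀ p ∈ s, VanishesAt L p

/-- No three distinct points of `s` are collinear. -/
def NoThreeCollinear (s : Set ProjPlane) : Prop :=
  ∀ p q r, p ∈ s → q ∈ s → r ∈ s → p ≠ q → p ≠ r → q ≠ r → ¬ Collin {p, q, r}

/-- `L` is a (the) line through the points `p` and `q`. -/
def IsLineThrough (L : Poly3) (p q : ProjPlane) : Prop :=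
  L ≠ 0 ∧ L.IsHomogeneous 1 ∧ VanishesAt L p ∧ VanishesAt L q

/-- `L` is the generalized Pascal line of the cubics `D₁` and `D₂` with respect to six
points `A, …, F`: the cubics have no common nonconstant factor, their common zero set
consists of exactly nine distinct points (the six given ones plus three further points),
and `L` is the line through the three further intersection points. -/
def IsGenPascalLine (A B C D E F : ProjPlane) (D₁ D₂ L : Poly3) : Prop :=
  IsRelPrime D₁ D₂ ∧ L ≠ 0 ∧ L.IsHomogeneous 1 ∧
    ∃ P Q R : ProjPlane,
      ([A, B, C, D, E, F, P, Q, R] : List ProjPlane).Pairwise (· ≠ ·) ∧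
      zeroSet D₁ ∩ zeroSet D₂ = {A, B, C, D, E, F, P, Q, R} ∧
      VanishesAt L P ∧ VanishesAt L Q ∧ VanishesAt L R

lemma MvPolynomial.IsHomogeneous.eval_smul {σ R : Type*} [CommSemiring R]
    {F : MvPolynomial σ R} {d : ℕ} (hF : F.IsHomogeneous d) (c : R) (v : σ → R) :
    eval (c • v) F = c ^ d * eval v F := by
  rw [eval_eq, eval_eq, Finset.mul_sum]
  refine Finset.sum_congr rfl fun e he => ?_
  have hd : ∑ i ∈ e.support, e i = d := (hF.degree_eq_sum_deg_support he).symm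
  simp only [Pi.smul_apply, smul_eq_mul, mul_pow, Finset.prod_mul_distrib,
    Finset.prod_pow_eq_pow_sum, hd]
  ring

lemma MvPolynomial.IsHomogeneous.right_of_mul {σ R : Type*} [CommRing R] [IsDomain R]
    {A B : MvPolynomial σ R} {a b : ℕ} (hA : A.IsHomogeneous a) (hA0 : A ≠ 0)
    (hAB : (A * B).IsHomogeneous (a + b)) : B.IsHomogeneous b := by
  let _ := MvPolynomial.gradedAlgebra (σ := σ) (R := R)
  have h : homogeneousComponent (a + b) (A * B) = A * homogeneousComponent b B := by
    rw [← decomposition.decompose'_apply, ← decomposition.decompose'_apply]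
    exact DirectSum.coe_decompose_mul_add_of_left_mem (homogeneousSubmodule σ R) hA
  rw [homogeneousComponent_eq_self hAB] at h
  rw [mul_left_cancel₀ hA0 h]
  exact homogeneousComponent_isHomogeneous b B

lemma MvPolynomial.finrank_homogeneousSubmodule (K : Type*) [Field K] (d : ℕ) :
    Module.finrank K (homogeneousSubmodule (Fin 3) K d) = (d + 2).choose 2 := by
  have hset : {e : Fin 3 →₀ ℕ | e.degree = d} =
      ((Finset.univ : Finset (Fin 3)).finsuppAntidiag d) := by
    ext e
    simp [Finsupp.degree_eq_sum]
  rw [homogeneousSubmodule_eq_finsupp_supported, hset,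
    (AddMonoidAlgebra.supportedEquivFinsupp _).finrank_eq, Module.finrank_finsupp_self,
    ← Nat.card_eq_fintype_card, Nat.card_coe_set_eq, Set.ncard_coe_finset,
    Finset.card_finsuppAntidiag_nat_eq_choose, Finset.card_univ, Fintype.card_fin,
    show 3 + d - 1 = d + 2 by omega, Nat.choose_symm_add]

instance finiteDimensional_homogeneousSubmodule (K : Type*) [Field K] (d : ℕ) :
    FiniteDimensional K (homogeneousSubmodule (Fin 3) K d) :=
  Module.Finite.iff_fg.2 (homogeneousSubmodule_fg _ _ d)

lemma finrank_map_mulLeft {K : Type*} [Field K] {A : MvPolynomial (Fin 3) K} (hA : A ≠ 0)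
    (d : ℕ) :
    Module.finrank K ((homogeneousSubmodule (Fin 3) K d).map (LinearMap.mulLeft K A)) =
      (d + 2).choose 2 := by
  rw [← (Submodule.equivMapOfInjective (LinearMap.mulLeft K A)
    (mul_right_injective₀ hA) _).finrank_eq, finrank_homogeneousSubmodule]

lemma exists_linear_form {σ K : Type*} [Fintype σ] [Field K] (f : Module.Dual K (σ → K)) :
    ∃ L : MvPolynomial σ K, L.IsHomogeneous 1 ∧ ∀ v, eval v L = f v := by
  classical
  refine ⟨∑ i, C (f (Pi.single i 1)) * X i,
    IsHomogeneous.sum _ _ _ fun i _ => isHomogeneous_C_mul_X _ _, fun v => ?_⟩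
  simp only [map_sum, map_mul, eval_C, eval_X]
  conv_rhs => rw [pi_eq_sum_univ' v]
  simp [mul_comm]

lemma exists_linear_form_separating {p q : ProjPlane} (hpq : p ≠ q) :
    ∃ L : Poly3, L.IsHomogeneous 1 ∧ ¬ VanishesAt L p ∧ VanishesAt L q := by
  have hmem : p.rep ∉ Submodule.span ℂ {q.rep} := by
    rw [Submodule.mem_span_singleton]
    intro h
    apply hpq
    rw [← p.mk_rep, ← q.mk_rep, Projectivization.mk_eq_mk_iff']
    exact h
  obtain ⟨f, hfp, hfq⟩ := Submodule.exists_le_ker_of_notMem hmem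
  obtain ⟨L, hL, hLf⟩ := exists_linear_form f
  refine ⟨L, hL, ?_, ?_⟩
  · rwa [VanishesAt, hLf]
  · rw [VanishesAt, hLf]
    exact hfq (Submodule.mem_span_singleton_self _)

lemma exists_linear_form_ne_zero (s : Finset ProjPlane) :
    ∃ f : Module.Dual ℂ (Fin 3 → ℂ), ∀ p ∈ s, f p.rep ≠ 0 := by
  obtain ⟨f, hf⟩ := Module.exists_dual_forall_apply_ne_zero (K := ℂ)
    (fun p : s => p.1.rep) fun p => p.1.rep_nonzero
  exact ⟨f, fun p hp => hf ⟨p, hp⟩⟩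

lemma exists_form_separating (s : Finset ProjPlane) {p : ProjPlane} (hp : p ∉ s) {d : ℕ}
    (hd : s.card ≤ d) :
    ∃ L : Poly3, L.IsHomogeneous d ∧ ¬ VanishesAt L p ∧ ∀ q ∈ s, VanishesAt L q := by
  classical
  induction s using Finset.induction_on generalizing d with
  | empty =>
    obtain ⟨f, hf⟩ := exists_linear_form_ne_zero {p}
    obtain ⟨L, hL, hLf⟩ := exists_linear_form f
    refine ⟨L ^ d, by simpa using hL.pow d, ?_, by simp⟩
    simp only [VanishesAt, map_pow, hLf]
    exact pow_ne_zero _ (hf p (by simp))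
  | insert q s hq ih =>
    rw [Finset.card_insert_of_notMem hq] at hd
    obtain ⟨e, rfl⟩ : ∃ e, d = e + 1 := ⟨d - 1, by omega⟩
    simp only [Finset.mem_insert, not_or] at hp
    obtain ⟨L, hL, hLp, hLs⟩ := ih hp.2 (Nat.le_of_succ_le_succ hd)
    obtain ⟨M, hM, hMp, hMq⟩ := exists_linear_form_separating hp.1
    simp only [VanishesAt] at *
    refine ⟨L * M, hL.mul hM, ?_, fun r hr => ?_⟩
    · simp [hLp, hMp]
    · rcases Finset.mem_insert.1 hr with rfl | hr
      · simp [hMq]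
      · simp [hLs r hr]

/-- Evaluation of forms of degree `d` at representatives of finitely many points. -/
def evalForms (s : Finset ProjPlane) (d : ℕ) :
    homogeneousSubmodule (Fin 3) ℂ d →ₗ[ℂ] (s → ℂ) :=
  LinearMap.pi fun p => (aeval p.1.rep).toLinearMap ∘ₗ Submodule.subtype _

lemma evalForms_apply (s : Finset ProjPlane) (d : ℕ) (P) (p : s) :
    evalForms s d P p = eval p.1.rep P.1 := by
  simp [evalForms, aeval_eq_eval]

lemma evalForms_surjective (s : Finset ProjPlane) {d : ℕ} (hd : s.card ≤ d) :
    Function.Surjective (evalForms s d) := by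
  classical
  rw [← LinearMap.range_eq_top, eq_top_iff, ← (Pi.basisFun ℂ s).span_eq, Submodule.span_le]
  rintro _ ⟨p, rfl⟩
  obtain ⟨L, hL, hLp, hLs⟩ := exists_form_separating (s.erase p.1) (p := p.1) (by simp)
    ((Finset.card_erase_le).trans hd)
  refine ⟨(eval p.1.rep L)⁻¹ • ⟨L, hL⟩, ?_⟩
  ext q
  rw [map_smul, Pi.smul_apply, evalForms_apply, Pi.basisFun_apply]
  by_cases hqp : q = p
  · subst hqp
    simp [inv_mul_cancel₀ hLp]
  · have : eval q.1.rep L = 0 := hLs q.1 (by simp [hqp])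
    simp [this, hqp]

/-- The weak form of the theorem of Bézout: two curves of degrees `m` and `n` with no common component
have at most `m * n` common points. -/
lemma card_le_mul_of_isRelPrime {A B : Poly3} {m n : ℕ} (hA : A.IsHomogeneous m)
    (hB : B.IsHomogeneous n) (hA0 : A ≠ 0) (hB0 : B ≠ 0) (hAB : IsRelPrime A B)
    (s : Finset ProjPlane) (hsA : ∀ p ∈ s, VanishesAt A p) (hsB : ∀ p ∈ s, VanishesAt B p) :
    s.card ≤ m * n := by
  set k := s.card
  set U := (homogeneousSubmodule (Fin 3) ℂ (k + n)).map (LinearMap.mulLeft ℂ A) with hU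
  set V := (homogeneousSubmodule (Fin 3) ℂ (k + m)).map (LinearMap.mulLeft ℂ B) with hV
  set W := (homogeneousSubmodule (Fin 3) ℂ k).map (LinearMap.mulLeft ℂ (A * B)) with hW
  set N := (LinearMap.ker (evalForms s (k + m + n))).map (Submodule.subtype _) with hN
  have hinf : U ⊓ V ≤ W := by
    rintro _ ⟨⟨P, hP, rfl⟩, ⟨Q, hQ, hPQ⟩⟩
    simp only [LinearMap.mulLeft_apply] at hPQ ⊢
    obtain ⟨c, rfl⟩ := hAB.dvd_of_dvd_mul_left (Dvd.intro P hPQ.symm)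
    have hc : c.IsHomogeneous k := by
      refine hA.right_of_mul hA0 ?_
      rw [add_comm m k]
      exact hQ
    exact ⟨c, hc, by simp only [LinearMap.mulLeft_apply]; rw [← hPQ]; ring⟩
  have hsup : U ⊔ V ≤ N := by
    refine sup_le ?_ ?_
    · rintro _ ⟨P, hP, rfl⟩
      have hh : (A * P).IsHomogeneous (k + m + n) := by
        convert hA.mul hP using 1; ring
      refine ⟨⟨A * P, hh⟩, ?_, rfl⟩
      rw [SetLike.mem_coe, LinearMap.mem_ker]
      ext p
      have : eval p.1.rep A = 0 := hsA p.1 p.2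
      simp [evalForms_apply, this]
    · rintro _ ⟨P, hP, rfl⟩
      have hh : (B * P).IsHomogeneous (k + m + n) := by
        convert hB.mul hP using 1; ring
      refine ⟨⟨B * P, hh⟩, ?_, rfl⟩
      rw [SetLike.mem_coe, LinearMap.mem_ker]
      ext p
      have : eval p.1.rep B = 0 := hsB p.1 p.2
      simp [evalForms_apply, this]
  have hNdim : s.card + Module.finrank ℂ N = (k + m + n + 2).choose 2 := by
    have h := LinearMap.finrank_range_add_finrank_ker (evalForms s (k + m + n))
    rw [LinearMap.range_eq_top.2 (evalForms_surjective s (by omega)), finrank_top,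
      Module.finrank_fintype_fun_eq_card, Fintype.card_coe, finrank_homogeneousSubmodule] at h
    rw [hN, ← (Submodule.equivMapOfInjective _ (Submodule.subtype_injective _) _).finrank_eq, h]
  have h1 : s.card + Module.finrank ℂ ↥(U ⊔ V) ≤ (k + m + n + 2).choose 2 := by
    rw [← hNdim]
    exact Nat.add_le_add_left (Submodule.finrank_mono hsup) _
  have h2 := Submodule.finrank_mono hinf
  have h3 := Submodule.finrank_sup_add_finrank_inf_eq U V
  rw [hU, finrank_map_mulLeft hA0, hV, finrank_map_mulLeft hB0, ← hU, ← hV] at h3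
  rw [hW, finrank_map_mulLeft (mul_ne_zero hA0 hB0)] at h2
  have key : (k + m + n + 2).choose 2 + (k + 2).choose 2 =
      (k + n + 2).choose 2 + (k + m + 2).choose 2 + m * n := by
    have hc (j : ℕ) : (((j + 2).choose 2 : ℕ) : ℚ) = (j + 2) * (j + 1) / 2 := by
      rw [Nat.cast_choose_two]; push_cast; ring
    have : (((k + m + n + 2).choose 2 + (k + 2).choose 2 : ℕ) : ℚ) =
        (((k + n + 2).choose 2 + (k + m + 2).choose 2 + m * n : ℕ) : ℚ) := by
      push_cast [hc]; ring
    exact_mod_cast this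
  omega

lemma MvPolynomial.IsHomogeneous.dvd_of_mul_lt_card {A B : Poly3} {m n : ℕ}
    (hA : A.IsHomogeneous m) (hB : B.IsHomogeneous n) (hirr : Irreducible A) (s : Finset ProjPlane)
    (hsA : ∀ p ∈ s, VanishesAt A p) (hsB : ∀ p ∈ s, VanishesAt B p) (hs : m * n < s.card) :
    A ∣ B := by
  by_contra h
  have hB0 : B ≠ 0 := by rintro rfl; exact h (dvd_zero A)
  exact hs.not_ge (card_le_mul_of_isRelPrime hA hB hirr.ne_zero hB0
    (hirr.isRelPrime_iff_not_dvd.2 h) s hsA hsB)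

/-- A form of positive degree over an algebraically closed field has a zero on every line. -/
lemma MvPolynomial.IsHomogeneous.exists_eval_add_smul_eq_zero {σ K : Type*} [Field K] [IsAlgClosed K]
    {F : MvPolynomial σ K} {d : ℕ} (hF : F.IsHomogeneous d) (hd : d ≠ 0) (u v : σ → K) :
    eval v F = 0 ∨ ∃ t : K, eval (u + t • v) F = 0 := by
  set p : Polynomial K :=
    MvPolynomial.aeval (fun i => Polynomial.C (u i) + Polynomial.X * Polynomial.C (v i)) F with hp
  set q : Polynomial K :=
    MvPolynomial.aeval (fun i => Polynomial.X * Polynomial.C (u i) + Polynomial.C (v i)) F with hq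
  have heval (g : σ → Polynomial K) (t : K) :
      (MvPolynomial.aeval g F).eval t = eval (fun i => (g i).eval t) F := by
    rw [← Polynomial.coe_evalRingHom, MvPolynomial.map_aeval]
    congr 1
    ext <;> simp
  have hpe (t : K) : p.eval t = eval (u + t • v) F := by
    rw [hp, heval]
    congr 2
    ext i
    simpa using mul_comm (v i) t
  have hqe (t : K) : q.eval t = eval (t • u + v) F := by
    rw [hq, heval]
    congr 2
    ext i
    simpa using mul_comm (u i) t
  by_cases hdeg : p.degree = 0
  · left
    obtain ⟨c, hc⟩ : ∃ c, p = Polynomial.C c := ⟨_, Polynomial.eq_C_of_degree_eq_zero hdeg⟩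
    have hqc : q = Polynomial.C c * Polynomial.X ^ d := by
      refine Polynomial.eq_of_infinite_eval_eq _ _ ?_
      refine (Set.finite_singleton (0 : K)).infinite_compl.mono fun t ht => ?_
      have ht : t ≠ 0 := ht
      have h : t • u + v = t • (u + t⁻¹ • v) := by
        rw [smul_add, smul_smul, mul_inv_cancel₀ ht, one_smul]
      rw [Set.mem_ofPred_eq, hqe, h, hF.eval_smul, ← hpe, hc]
      simp only [Polynomial.eval_mul, Polynomial.eval_pow, Polynomial.eval_C, Polynomial.eval_X]
      ring
    have h0 := hqe 0
    rw [hqc] at h0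
    simpa [hd] using h0.symm
  · right
    obtain ⟨t, ht⟩ := IsAlgClosed.exists_root p hdeg
    exact ⟨t, by rw [← hpe]; exact ht⟩

lemma MvPolynomial.IsHomogeneous.exists_vanishesAt_notMem {E : Poly3} {m : ℕ}
    (hE : E.IsHomogeneous m) (hm : m ≠ 0) (s : Finset ProjPlane) :
    ∃ p : ProjPlane, VanishesAt E p ∧ p ∉ s := by
  obtain ⟨f, hf⟩ := exists_linear_form_ne_zero s
  have hker : 1 < Module.finrank ℂ (LinearMap.ker f) := by
    have h := LinearMap.finrank_range_add_finrank_ker f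
    have h' := (LinearMap.range f).finrank_le
    simp at h h'
    omega
  have : Nontrivial (LinearMap.ker f) := Module.nontrivial_of_finrank_pos (R := ℂ) (by omega)
  obtain ⟨u, hu⟩ := exists_ne (0 : LinearMap.ker f)
  obtain ⟨v, huv⟩ := exists_linearIndependent_pair_of_one_lt_finrank hker hu
  rw [LinearIndependent.pair_iff] at huv
  obtain ⟨w, hw0, hw⟩ : ∃ w : LinearMap.ker f, w ≠ 0 ∧ eval (w : Fin 3 → ℂ) E = 0 := by
    rcases hE.exists_eval_add_smul_eq_zero hm (u : Fin 3 → ℂ) v with h | ⟨t, h⟩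
    · refine ⟨v, ?_, h⟩
      rintro rfl
      simpa using huv 0 1
    · refine ⟨u + t • v, fun h0 => ?_, by simpa using h⟩
      simpa using (huv 1 t (by simpa using h0)).1
  have hw0' : (w : Fin 3 → ℂ) ≠ 0 := by simpa using hw0
  obtain ⟨a, ha⟩ := Projectivization.exists_smul_eq_mk_rep ℂ (w : Fin 3 → ℂ) hw0'
  refine ⟨Projectivization.mk ℂ (w : Fin 3 → ℂ) hw0', ?_, fun hmem => hf _ hmem ?_⟩
  · rw [VanishesAt, ← ha, Units.smul_def, hE.eval_smul, hw, mul_zero]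
  · rw [← ha, Units.smul_def, map_smul, LinearMap.mem_ker.1 w.2, smul_zero]

lemma MvPolynomial.IsHomogeneous.not_isUnit {σ K : Type*} [Field K] {F : MvPolynomial σ K}
    {d : ℕ} (hF : F.IsHomogeneous d) (hd : d ≠ 0) : ¬ IsUnit F := by
  intro h
  have h0 := hF.eval_smul 0 0
  rw [zero_pow hd, zero_mul] at h0
  exact (h.map (eval ((0 : K) • (0 : σ → K)))).ne_zero h0

/-- If two curves of degree `n` with no common nonconstant factor meet in exactly `n²`
distinct points and `n·m` of these points lie on an irreducible curve of degree `m < n`,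
then the remaining `n·(n-m)` points lie on a curve of degree at most `n - m`. -/
theorem bezout_residual (n m : ℕ) (hmn : m < n) (F G : Poly3) (hF : F ≠ 0) (hG : G ≠ 0)
    (hFh : F.IsHomogeneous n) (hGh : G.IsHomogeneous n) (hrp : IsRelPrime F G)
    (S : Finset ProjPlane) (hS : (S : Set ProjPlane) = zeroSet F ∩ zeroSet G)
    (hScard : S.card = n ^ 2)
    (E : Poly3) (hEirr : Irreducible E) (hEh : E.IsHomogeneous m)
    (T : Finset ProjPlane) (hTS : T ⊆ S) (hTcard : T.card = n * m)
    (hET : ∀ p ∈ T, VanishesAt E p) :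
    ∃ d ≤ n - m, ∃ H : Poly3, H ≠ 0 ∧ H.IsHomogeneous d ∧
      ∀ p ∈ S, p ∉ T → VanishesAt H p := by
  have hn : n ≠ 0 := by omega
  have hm : m ≠ 0 := by
    rintro rfl
    obtain ⟨c, rfl⟩ : ∃ c, E = C c :=
      ⟨_, totalDegree_eq_zero_iff_eq_C.1 (Nat.le_zero.1 hEh.totalDegree_le)⟩
    have hc : c ≠ 0 := by
      rintro rfl
      exact hEirr.ne_zero C_0
    exact hEirr.not_isUnit (hc.isUnit.map C)
  have hSF : ∀ p ∈ S, VanishesAt F p := fun p hp => (hS.subset hp).1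
  have hSG : ∀ p ∈ S, VanishesAt G p := fun p hp => (hS.subset hp).2
  have hES : ∀ p ∈ S, p ∉ T → ¬ VanishesAt E p := by
    classical
    intro p hp hpT hEp
    have hsub : insert p T ⊆ S := Finset.insert_subset hp hTS
    have hEs : ∀ q ∈ insert p T, VanishesAt E q := by
      simpa [hEp] using hET
    have hcard : m * n < (insert p T).card := by
      rw [Finset.card_insert_of_notMem hpT, hTcard, mul_comm]
      omega
    exact hEirr.not_isUnit (hrp
      (hEh.dvd_of_mul_lt_card hFh hEirr _ hEs (fun q hq => hSF q (hsub hq)) hcard)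
      (hEh.dvd_of_mul_lt_card hGh hEirr _ hEs (fun q hq => hSG q (hsub hq)) hcard))
  obtain ⟨q, hEq, hqS⟩ := hEh.exists_vanishesAt_notMem hm S
  set a := eval q.rep F with ha
  set b := eval q.rep G with hb
  set P : Poly3 := C b * F - C a * G with hP
  have hPh : P.IsHomogeneous n := (hFh.C_mul b).sub (hGh.C_mul a)
  have hPS : ∀ p ∈ S, VanishesAt P p := fun p hp => by
    have h1 : eval p.rep F = 0 := hSF p hp
    have h2 : eval p.rep G = 0 := hSG p hp
    simp [VanishesAt, hP, h1, h2]
  have hPq : VanishesAt P q := by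
    simp [VanishesAt, hP, ← ha, ← hb, mul_comm]
  have hP0 : P ≠ 0 := by
    intro h0
    have heq : C b * F = C a * G := sub_eq_zero.1 h0
    have hab : a ≠ 0 ∨ b ≠ 0 := by
      by_contra! h
      exact hqS (hS.superset ⟨h.1, h.2⟩)
    rcases hab with h | h
    · have : F ∣ G := (h.isUnit.map C).dvd_mul_left.1 (heq ▸ dvd_mul_left F (C b))
      exact hFh.not_isUnit hn (hrp dvd_rfl this)
    · have : G ∣ F := (h.isUnit.map C).dvd_mul_left.1 (heq ▸ dvd_mul_left G (C a))
      exact hGh.not_isUnit hn (hrp this dvd_rfl)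
  have hEP : E ∣ P := by
    classical
    have hqT : q ∉ T := fun h => hqS (hTS h)
    refine hEh.dvd_of_mul_lt_card hPh hEirr (insert q T) ?_ ?_ ?_
    · simpa [hEq] using hET
    · simpa [hPq] using fun p hp => hPS p (hTS hp)
    · rw [Finset.card_insert_of_notMem hqT, hTcard, mul_comm]
      omega
  obtain ⟨H, hH⟩ := hEP
  refine ⟨n - m, le_rfl, H, ?_, ?_, fun p hp hpT => ?_⟩
  · rintro rfl
    exact hP0 (by rw [hH, mul_zero])
  · refine hEh.right_of_mul hEirr.ne_zero ?_
    rwa [← hH, Nat.add_sub_cancel' hmn.le]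
  · have h := hPS p hp
    rw [VanishesAt, hH, map_mul, mul_eq_zero] at h
    exact h.resolve_left (hES p hp hpT)
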